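/- arXiv:1411.1165 — 3 statements merged into one kernel-verified Lean document; each statement's English description precedes it below -/
import Mathlib

section
/- Let p1, p2 be probability mass functions on ℕ such that for each of them there exists t' > 1 with ∑_{j=0}^∞ (1+t')^j p_i(j) < ∞ (i = 1,2). Then for every α ≥ 2, d_tv(p1,p2) ≤ d_α(p1,p2). -/
open scoped BigOperators ENNReal

/-- A probability mass function on ℕ. -/
def IsPmf (p : ℕ → ℝ) : Prop := (∀ j, 0 ≤ p j) ∧ ∑' j, p j = 1

/-- Total variation distance between two pmfs on ℕ. -/
noncomputable def dtv (p q : ℕ → ℝ) : ℝ := (1 / 2) * ∑' j, |p j - q j|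

/-- Descending factorial (j)_k = j(j-1)⋯(j-k+1), as a real number. -/
noncomputable def descFac (j k : ℕ) : ℝ := ∏ i ∈ Finset.range k, ((j : ℝ) - i)

/-- k-th descending factorial moment of a pmf p. -/
noncomputable def facMoment (k : ℕ) (p : ℕ → ℝ) : ℝ := ∑' j, descFac j k * p j

/-- Factorial moment distance of order α, with values in [0,∞]:
    d_α(p,q) = ∑_{k=1}^∞ (α^{k-1}/k!) |M_k(p) - M_k(q)|. -/
noncomputable def dFM (α : ℝ) (p q : ℕ → ℝ) : ℝ≥0∞ :=
  ∑' k : ℕ, ENNReal.ofReal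
    (α ^ k / (Nat.factorial (k + 1) : ℝ) * |facMoment (k + 1) p - facMoment (k + 1) q|)

/-- The Poisson(λ) pmf. -/
noncomputable def poissonPmf (lam : ℝ) (j : ℕ) : ℝ :=
  Real.exp (-lam) * lam ^ j / (Nat.factorial j : ℝ)

/-- The generalized matching pmf p_{n;λ}. -/
noncomputable def genMatch (n : ℕ) (lam : ℝ) (j : ℕ) : ℝ :=
  if j ≤ n then
    lam ^ j / (Nat.factorial j : ℝ) * ∑ i ∈ Finset.range (n - j + 1), (-lam) ^ i / (Nat.factorial i : ℝ)
  else 0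

theorem descFac_eq_factorial_mul_choose (j k : ℕ) :
    descFac j k = (k.factorial : ℝ) * (j.choose k : ℝ) := by
  rw [descFac, ← descPochhammer_eval_eq_prod_range, descPochhammer_eval_eq_descFactorial,
    Nat.descFactorial_eq_factorial_mul_choose]
  push_cast
  rfl

theorem sum_choose_mul_choose_mul_pow (x : ℝ) (i j : ℕ) :
    ∑ k ∈ Finset.range (i + 1), (i.choose k : ℝ) * (k.choose j : ℝ) * x ^ (k - j) =
      (i.choose j : ℝ) * (1 + x) ^ (i - j) := by
  rcases lt_or_ge i j with h | h
  · rw [Nat.choose_eq_zero_of_lt h, Finset.sum_eq_zero]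
    · simp
    · intro k hk
      rw [Nat.choose_eq_zero_of_lt (n := k) (k := j) (by grind)]
      simp
  · obtain ⟨n, rfl⟩ := Nat.exists_eq_add_of_le h
    rw [add_assoc, Finset.sum_range_add, Finset.sum_eq_zero, zero_add, add_comm 1 x, add_pow,
      Finset.mul_sum, Nat.add_sub_cancel_left]
    · refine Finset.sum_congr rfl fun l hl => ?_
      have hmul : (j + n).choose (j + l) * (j + l).choose j = (j + n).choose j * n.choose l := by
        have := Nat.choose_mul (n := j + n) (k := j + l) (s := j) (by grind)
        simpa using this
      rw [Nat.add_sub_cancel_left, ← Nat.cast_mul, hmul]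
      push_cast
      ring
    · intro k hk
      rw [Nat.choose_eq_zero_of_lt (n := k) (k := j) (by grind)]
      simp

theorem summable_choose_mul_two_pow_mul {p : ℕ → ℝ} (hp : ∀ j, 0 ≤ p j) {t : ℝ} (ht : 1 < t)
    (hs : Summable fun j => (1 + t) ^ j * p j) (j : ℕ) :
    Summable fun i => (i.choose j : ℝ) * 2 ^ i * p i := by
  obtain ⟨x, hx, rfl⟩ : ∃ x : ℝ, 0 < x ∧ t = 2 * x + 1 :=
    ⟨(t - 1) / 2, by linarith, by ring⟩
  refine .of_nonneg_of_le (fun i => by have := hp i; positivity) (fun i => ?_)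
    (hs.mul_left (x ^ j)⁻¹)
  have hbinom : x ^ j * (i.choose j : ℝ) ≤ (x + 1) ^ i := by
    rcases lt_or_ge i j with h | h
    · rw [Nat.choose_eq_zero_of_lt h]
      simp only [Nat.cast_zero, mul_zero]
      positivity
    · rw [add_pow]
      have := Finset.single_le_sum (f := fun m => x ^ m * 1 ^ (i - m) * (i.choose m : ℝ))
        (s := Finset.range (i + 1)) (fun m _ => by positivity) (a := j) (by grind)
      simpa using this
  have hpow : (1 + (2 * x + 1)) ^ i = (x + 1) ^ i * 2 ^ i := by
    rw [← mul_pow]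
    ring
  rw [hpow, ← div_eq_inv_mul, le_div_iff₀ (by positivity)]
  calc (i.choose j : ℝ) * 2 ^ i * p i * x ^ j
      = x ^ j * (i.choose j : ℝ) * (2 ^ i * p i) := by ring
    _ ≤ (x + 1) ^ i * (2 ^ i * p i) :=
        mul_le_mul_of_nonneg_right hbinom (mul_nonneg (by positivity) (hp i))
    _ = (x + 1) ^ i * 2 ^ i * p i := by ring

theorem hasSum_choose_mul_choose_mul_pow (x : ℝ) (i j : ℕ) :
    HasSum (fun k => (i.choose k : ℝ) * (k.choose j : ℝ) * x ^ (k - j))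
      ((i.choose j : ℝ) * (1 + x) ^ (i - j)) := by
  rw [← sum_choose_mul_choose_mul_pow]
  refine hasSum_sum_of_ne_finset_zero fun k hk => ?_
  rw [Nat.choose_eq_zero_of_lt (n := i) (k := k) (by grind)]
  simp

/-- Inversion of the binomial moments `∑' i, i.choose k * q i` of a sequence. -/
theorem hasSum_binomial_moment_inversion {q : ℕ → ℝ} (j : ℕ)
    (hq : Summable fun i => (i.choose j : ℝ) * 2 ^ i * |q i|) :
    HasSum (fun k => (k.choose j : ℝ) * (-1) ^ (k - j) * ∑' i, (i.choose k : ℝ) * q i) (q j) := by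
  let F : ℕ × ℕ → ℝ := fun z =>
    (z.1.choose z.2 : ℝ) * (z.2.choose j : ℝ) * (-1) ^ (z.2 - j) * q z.1
  have habs (i k : ℕ) : ‖F (i, k)‖ =
      (i.choose k : ℝ) * (k.choose j : ℝ) * 1 ^ (k - j) * |q i| := by
    simp [F]
  have hF : Summable F := by
    refine Summable.of_norm ?_
    rw [summable_prod_of_nonneg fun z => norm_nonneg _]
    have hrow (i : ℕ) : HasSum (fun k => ‖F (i, k)‖)
        ((i.choose j : ℝ) * (1 + 1) ^ (i - j) * |q i|) := by
      simp only [habs]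
      exact (hasSum_choose_mul_choose_mul_pow 1 i j).mul_right _
    refine ⟨fun i => (hrow i).summable, ?_⟩
    simp only [fun i => (hrow i).tsum_eq]
    refine .of_nonneg_of_le (fun i => by positivity) (fun i => ?_) hq
    norm_num only
    gcongr
    · norm_num
    · omega
  have hsum : ∑' z, F z = q j := by
    rw [hF.tsum_prod, tsum_eq_single j]
    · simpa using ((hasSum_choose_mul_choose_mul_pow (-1) j j).mul_right (q j)).tsum_eq
    · intro i hi
      refine ((hasSum_choose_mul_choose_mul_pow (-1) i j).mul_right (q i)).tsum_eq.trans ?_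
      rcases lt_or_gt_of_ne hi with h | h
      · simp [Nat.choose_eq_zero_of_lt h]
      · have : i - j ≠ 0 := by omega
        simp [this]
  have hswap : HasSum (F ∘ Prod.swap) (q j) := by
    rw [← hsum]
    exact (Equiv.prodComm ℕ ℕ).hasSum_iff.mpr hF.hasSum
  have hcol := hswap.summable.prod.hasSum
  rw [← hswap.summable.tsum_prod, hswap.tsum_eq] at hcol
  refine (congrArg (HasSum · (q j)) (funext fun k => ?_)).mpr hcol
  rw [← tsum_mul_left]
  refine tsum_congr fun i => ?_
  simp only [F, Function.comp_apply, Prod.swap_prod_mk]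
  ring

/-- The `ℓ¹` norm of a sequence is bounded by its binomial moments weighted by `2 ^ k`. -/
theorem tsum_ofReal_abs_le_tsum_two_pow_mul {q : ℕ → ℝ}
    (hq : ∀ j, Summable fun i => (i.choose j : ℝ) * 2 ^ i * |q i|) :
    ∑' j, ENNReal.ofReal |q j| ≤
      ∑' k, ENNReal.ofReal (2 ^ k * |∑' i, (i.choose k : ℝ) * q i|) := by
  set m : ℕ → ℝ := fun k => ∑' i, (i.choose k : ℝ) * q i with hm
  calc ∑' j, ENNReal.ofReal |q j|
      ≤ ∑' j, ∑' k, ENNReal.ofReal ((k.choose j : ℝ) * |m k|) := by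
        refine ENNReal.tsum_le_tsum fun j => ?_
        have h := hasSum_binomial_moment_inversion j (hq j)
        have hle := enorm_tsum_le_tsum_enorm (f := fun k =>
          (k.choose j : ℝ) * (-1) ^ (k - j) * m k)
        rw [h.tsum_eq] at hle
        simpa [← ofReal_norm, abs_mul] using hle
    _ = ∑' k, ∑' j, ENNReal.ofReal ((k.choose j : ℝ) * |m k|) := ENNReal.tsum_comm
    _ = ∑' k, ENNReal.ofReal (2 ^ k * |m k|) := by
        refine tsum_congr fun k => ?_
        rw [tsum_eq_sum (s := Finset.range (k + 1)), ← ENNReal.ofReal_sum_of_nonneg,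
          ← Finset.sum_mul, ← Nat.cast_sum, Nat.sum_range_choose]
        · simp
        · intros
          positivity
        · intro j hj
          rw [Nat.choose_eq_zero_of_lt (n := k) (k := j) (by grind)]
          simp

theorem stmt7 (p1 p2 : ℕ → ℝ) (h1 : IsPmf p1) (h2 : IsPmf p2)
    (ht1 : ∃ t' : ℝ, 1 < t' ∧ Summable fun j => (1 + t') ^ j * p1 j)
    (ht2 : ∃ t' : ℝ, 1 < t' ∧ Summable fun j => (1 + t') ^ j * p2 j)
    (α : ℝ) (hα : 2 ≤ α) :
    ENNReal.ofReal (dtv p1 p2) ≤ dFM α p1 p2 := by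
  obtain ⟨t1, ht1, hs1⟩ := ht1
  obtain ⟨t2, ht2, hs2⟩ := ht2
  have hS1 := summable_choose_mul_two_pow_mul h1.1 ht1 hs1
  have hS2 := summable_choose_mul_two_pow_mul h2.1 ht2 hs2
  have hC {p : ℕ → ℝ} (hp : ∀ j, 0 ≤ p j)
      (hS : ∀ j, Summable fun i => (i.choose j : ℝ) * 2 ^ i * p i) (k : ℕ) :
      Summable fun i => (i.choose k : ℝ) * p i := by
    refine .of_nonneg_of_le (fun i => mul_nonneg (by positivity) (hp i)) (fun i => ?_) (hS k)
    exact mul_le_mul_of_nonneg_right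
      (le_mul_of_one_le_right (by positivity) (one_le_pow₀ (by norm_num))) (hp i)
  set q : ℕ → ℝ := fun i => p1 i - p2 i with hqdef
  have habs (i : ℕ) : |q i| ≤ p1 i + p2 i := by
    have := h1.1 i
    have := h2.1 i
    rw [abs_le]
    constructor <;> simp only [hqdef] <;> linarith
  have hq (j : ℕ) : Summable fun i => (i.choose j : ℝ) * 2 ^ i * |q i| := by
    refine .of_nonneg_of_le (fun i => by positivity) (fun i => ?_) ((hS1 j).add (hS2 j))
    rw [← mul_add]
    exact mul_le_mul_of_nonneg_left (habs i) (by positivity)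
  have hmoment (k : ℕ) : facMoment k p1 - facMoment k p2 =
      (k.factorial : ℝ) * ∑' i, (i.choose k : ℝ) * q i := by
    simp only [facMoment, descFac_eq_factorial_mul_choose, mul_assoc, tsum_mul_left, hqdef,
      mul_sub]
    rw [(hC h1.1 hS1 k).tsum_sub (hC h2.1 hS2 k), mul_sub]
  have hzero : ∑' i, (i.choose 0 : ℝ) * q i = 0 := by
    have hp1 := hC h1.1 hS1 0
    have hp2 := hC h2.1 hS2 0
    simp only [Nat.choose_zero_right, Nat.cast_one, one_mul] at hp1 hp2 ⊢
    rw [hp1.tsum_sub hp2, h1.2, h2.2, sub_self]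
  have hqs : Summable fun i => |q i| := by
    have hp1 := hC h1.1 hS1 0
    have hp2 := hC h2.1 hS2 0
    simp only [Nat.choose_zero_right, Nat.cast_one, one_mul] at hp1 hp2
    exact .of_nonneg_of_le (fun i => abs_nonneg _) habs (hp1.add hp2)
  calc ENNReal.ofReal (dtv p1 p2)
      = ENNReal.ofReal (1 / 2) * ∑' j, ENNReal.ofReal |q j| := by
        rw [dtv, ENNReal.ofReal_mul (by norm_num),
          ENNReal.ofReal_tsum_of_nonneg (fun _ => abs_nonneg _) hqs]
    _ ≤ ENNReal.ofReal (1 / 2) *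
          ∑' k, ENNReal.ofReal (2 ^ k * |∑' i, (i.choose k : ℝ) * q i|) := by
        exact mul_le_mul_right (tsum_ofReal_abs_le_tsum_two_pow_mul hq) _
    _ = ∑' k, ENNReal.ofReal (2 ^ k * |∑' i, (i.choose (k + 1) : ℝ) * q i|) := by
        rw [tsum_eq_zero_add' ENNReal.summable, hzero, abs_zero, mul_zero, ENNReal.ofReal_zero,
          zero_add, ← ENNReal.tsum_mul_left]
        refine tsum_congr fun k => ?_
        rw [← ENNReal.ofReal_mul (by norm_num)]
        congr 1
        ring
    _ ≤ dFM α p1 p2 := by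
        refine ENNReal.tsum_le_tsum fun k => ENNReal.ofReal_le_ofReal ?_
        rw [hmoment, abs_mul, Nat.abs_cast, ← mul_assoc, div_mul_cancel₀ _ (by positivity)]
        gcongr
end

section
/- For every natural number n, every λ ∈ (0,1], and every α > 0: for all probability mass functions p on ℕ supported on {0,1,…,n}, d_α(p, q_λ) ≥ d_α(p_{n;λ}, q_λ), where q_λ is the Poisson(λ) pmf. That is, the infimum of d_α(p, q_λ) over pmfs supported on {0,1,…,n} is attained at the generalized matching pmf p_{n;λ}. -/
open scoped BigOperators ENNReal

theorem descFac_eq_descFactorial (j k : ℕ) : descFac j k = (j.descFactorial k : ℝ) := by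
  rw [descFac, ← descPochhammer_eval_eq_prod_range, descPochhammer_eval_eq_descFactorial]

theorem descFac_eq_zero {j k : ℕ} (h : j < k) : descFac j k = 0 := by
  rw [descFac_eq_descFactorial, Nat.descFactorial_of_lt h, Nat.cast_zero]

theorem descFac_add_div_factorial (m k : ℕ) :
    descFac (m + k) k / ((m + k).factorial : ℝ) = 1 / (m.factorial : ℝ) := by
  have h := Nat.factorial_mul_descFactorial (Nat.le_add_left k m)
  rw [Nat.add_sub_cancel] at h
  rw [descFac_eq_descFactorial, ← h, Nat.cast_mul]
  have h1 : (m.factorial : ℝ) ≠ 0 := by positivity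
  have h2 : ((m + k).descFactorial k : ℝ) ≠ 0 := by
    exact_mod_cast (Nat.descFactorial_pos.2 (Nat.le_add_left k m)).ne'
  field_simp

theorem facMoment_eq_zero {n k : ℕ} {p : ℕ → ℝ} (hp : ∀ j, n < j → p j = 0) (hk : n < k) :
    facMoment k p = 0 := by
  rw [facMoment, ← tsum_zero (α := ℝ) (β := ℕ)]
  refine tsum_congr fun j => ?_
  rcases le_or_gt j n with h | h
  · rw [descFac_eq_zero (h.trans_lt hk), zero_mul]
  · rw [hp j h, mul_zero]

theorem hasSum_facMoment_poissonPmf (lam : ℝ) (k : ℕ) :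
    HasSum (fun j => descFac j k * poissonPmf lam j) (lam ^ k) := by
  rw [← hasSum_nat_add_iff' k, Finset.sum_eq_zero, sub_zero]
  · have h : HasSum (fun m : ℕ => lam ^ m / (m.factorial : ℝ)) (Real.exp lam) := by
      rw [Real.exp_eq_exp_ℝ]
      exact NormedSpace.expSeries_div_hasSum_exp lam
    have h1 : Real.exp (-lam) * lam ^ k * Real.exp lam = lam ^ k := by
      rw [mul_right_comm, ← Real.exp_add, neg_add_cancel, Real.exp_zero, one_mul]
    have h2 : ∀ m, descFac (m + k) k * poissonPmf lam (m + k) =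
        Real.exp (-lam) * lam ^ k * (lam ^ m / (m.factorial : ℝ)) := by
      intro m
      calc descFac (m + k) k * poissonPmf lam (m + k)
          = Real.exp (-lam) * lam ^ (m + k) *
              (descFac (m + k) k / ((m + k).factorial : ℝ)) := by
            rw [poissonPmf]; ring
        _ = _ := by rw [descFac_add_div_factorial]; ring
    simp only [h2]
    simpa only [h1] using h.mul_left (Real.exp (-lam) * lam ^ k)
  · intro j hj
    rw [descFac_eq_zero (Finset.mem_range.1 hj), zero_mul]

theorem sum_pow_div_factorial_mul_neg_pow_div_factorial (x : ℝ) (N : ℕ) :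
    ∑ m ∈ Finset.range (N + 2),
      x ^ m / (m.factorial : ℝ) * ((-x) ^ (N + 1 - m) / ((N + 1 - m).factorial : ℝ)) = 0 := by
  have h := add_pow x (-x) (N + 1)
  rw [add_neg_cancel, zero_pow N.succ_ne_zero] at h
  have h1 : ((N + 1).factorial : ℝ) ≠ 0 := by positivity
  refine (mul_eq_zero.1 (?_ : ((N + 1).factorial : ℝ) * _ = 0)).resolve_left h1
  rw [h, Finset.mul_sum]
  refine Finset.sum_congr rfl fun m hm => ?_
  rw [Nat.cast_choose ℝ (Nat.lt_succ_iff.1 (Finset.mem_range.1 hm))]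
  ring

theorem sum_pow_div_factorial_mul_sum_neg_pow (x : ℝ) (N : ℕ) :
    ∑ m ∈ Finset.range (N + 1), x ^ m / (m.factorial : ℝ) *
      ∑ i ∈ Finset.range (N - m + 1), (-x) ^ i / (i.factorial : ℝ) = 1 := by
  induction N with
  | zero => simp
  | succ N ih =>
    have h : ∀ m ∈ Finset.range (N + 1), x ^ m / (m.factorial : ℝ) *
        ∑ i ∈ Finset.range (N + 1 - m + 1), (-x) ^ i / (i.factorial : ℝ) =
        x ^ m / (m.factorial : ℝ) *
          ∑ i ∈ Finset.range (N - m + 1), (-x) ^ i / (i.factorial : ℝ) +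
        x ^ m / (m.factorial : ℝ) *
          ((-x) ^ (N + 1 - m) / ((N + 1 - m).factorial : ℝ)) := by
      intro m hm
      rw [Finset.sum_range_succ, mul_add, Nat.sub_add_comm (Nat.lt_succ_iff.1 (Finset.mem_range.1 hm))]
    have h0 := sum_pow_div_factorial_mul_neg_pow_div_factorial x N
    rw [Finset.sum_range_succ] at h0
    rw [Finset.sum_range_succ, Finset.sum_congr rfl h, Finset.sum_add_distrib, ih]
    simp only [Nat.sub_self, zero_add, Finset.sum_range_one] at h0 ⊢
    linarith

theorem genMatch_eq_zero {n : ℕ} (lam : ℝ) {j : ℕ} (h : n < j) : genMatch n lam j = 0 :=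
  if_neg h.not_ge

theorem facMoment_genMatch {n k : ℕ} (lam : ℝ) (hk : k ≤ n) :
    facMoment k (genMatch n lam) = lam ^ k := by
  obtain ⟨N, rfl⟩ := Nat.exists_eq_add_of_le' hk
  rw [facMoment, tsum_eq_sum (s := Finset.range (N + k + 1)), add_right_comm, add_comm _ k,
    Finset.sum_range_add, Finset.sum_eq_zero, zero_add,
    ← mul_one (lam ^ k), ← sum_pow_div_factorial_mul_sum_neg_pow lam N, Finset.mul_sum]
  · refine Finset.sum_congr rfl fun m hm => ?_
    have hm : m ≤ N := Nat.lt_succ_iff.1 (Finset.mem_range.1 hm)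
    rw [genMatch, if_pos (by omega), add_comm k m, Nat.add_sub_add_right]
    calc _ = lam ^ (m + k) * (descFac (m + k) k / ((m + k).factorial : ℝ)) *
            ∑ i ∈ Finset.range (N - m + 1), (-lam) ^ i / (i.factorial : ℝ) := by ring
      _ = _ := by rw [descFac_add_div_factorial]; ring
  · intro j hj
    rw [descFac_eq_zero (Finset.mem_range.1 hj), zero_mul]
  · intro j hj
    rw [genMatch_eq_zero lam (by simpa [Nat.lt_succ_iff] using hj), mul_zero]

theorem stmt10 (n : ℕ) (lam : ℝ) (hlam : 0 < lam ∧ lam ≤ 1) (α : ℝ) (hα : 0 < α)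
    (p : ℕ → ℝ) (hp : IsPmf p) (hsupp : ∀ j, n < j → p j = 0) :
    dFM α (genMatch n lam) (poissonPmf lam) ≤ dFM α p (poissonPmf lam) := by
  refine ENNReal.tsum_le_tsum fun k => ENNReal.ofReal_le_ofReal ?_
  refine mul_le_mul_of_nonneg_left ?_ (by positivity)
  rcases le_or_gt (k + 1) n with hk | hk
  · have h : facMoment (k + 1) (poissonPmf lam) = lam ^ (k + 1) :=
      (hasSum_facMoment_poissonPmf lam (k + 1)).tsum_eq
    rw [facMoment_genMatch lam hk, h, sub_self, abs_zero]
    exact abs_nonneg _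
  · rw [facMoment_eq_zero hsupp hk, facMoment_eq_zero (fun _ => genMatch_eq_zero lam) hk]
end

section
/- For every λ ∈ (0,1] and natural number n, the total variation distance d_tv(n) = d_tv(p_{n;λ}, q_λ) satisfies the two inequalities: d_tv(n) > (2^n λ^{n+1}/(n+1)!) · (1 − (2λ/(n+2))·(1 − 1/2^{n+1})), and d_tv(n) < (2^n λ^{n+1}/(n+1)!) · (1 − (2λ/(n+2))·(1 − 1/2^{n+1}) + (4λ²/((n+2)(n+3)))·(1 − (n+3)/2^{n+2})). -/
open scoped BigOperators ENNReal

open MeasureTheory intervalIntegral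

/-- Integral form of the alternating Taylor remainder of `exp (-x)`. -/
lemma taylor_exp_neg_sub (x : ℝ) (m : ℕ) :
    ∑ i ∈ Finset.range (m + 1), (-x) ^ i / (i.factorial : ℝ) - Real.exp (-x)
      = (-1) ^ m * ∫ t in (0 : ℝ)..x, (x - t) ^ m / (m.factorial : ℝ) * Real.exp (-t) := by
  induction m with
  | zero =>
    have h : ∫ t in (0 : ℝ)..x, Real.exp (-t) = -Real.exp (-x) - -Real.exp (-0) :=
      integral_eq_sub_of_hasDerivAt (f := fun t => -Real.exp (-t))
        (fun t _ => (hasDerivAt_id t).neg.exp.neg.congr_deriv (by simp))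
        (Continuous.intervalIntegrable (by fun_prop) _ _)
    simp [h]
    ring
  | succ m ih =>
    have h : ∫ t in (0 : ℝ)..x, (-((x - t) ^ m / (m.factorial : ℝ) * Real.exp (-t))
          - (x - t) ^ (m + 1) / ((m + 1).factorial : ℝ) * Real.exp (-t))
        = (x - x) ^ (m + 1) / ((m + 1).factorial : ℝ) * Real.exp (-x)
          - (x - 0) ^ (m + 1) / ((m + 1).factorial : ℝ) * Real.exp (-0) := by
      refine integral_eq_sub_of_hasDerivAt
        (f := fun t => (x - t) ^ (m + 1) / ((m + 1).factorial : ℝ) * Real.exp (-t))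
        (fun t _ => ?_) (Continuous.intervalIntegrable (by fun_prop) _ _)
      have hd := ((((hasDerivAt_id t).const_sub x).pow (m + 1)).div_const
        ((m + 1).factorial : ℝ)).mul (hasDerivAt_id t).neg.exp
      refine hd.congr_deriv ?_
      have : (m.factorial : ℝ) ≠ 0 := by positivity
      simp [Nat.factorial_succ]
      field_simp
      ring
    rw [intervalIntegral.integral_sub (Continuous.intervalIntegrable (by fun_prop) _ _)
      (Continuous.intervalIntegrable (by fun_prop) _ _), intervalIntegral.integral_neg] at h
    simp only [sub_self, sub_zero, neg_zero, Real.exp_zero, ne_eq, Nat.add_eq_zero_iff,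
      one_ne_zero, and_false, not_false_eq_true, zero_pow, zero_div, zero_mul, mul_one] at h
    rw [Finset.sum_range_succ, neg_pow x (m + 1)]
    linear_combination ih + (-1) ^ (m + 1) * h

/-- Integral form of the upper tail of the Poisson distribution. -/
lemma one_sub_sum_poissonPmf (x : ℝ) (m : ℕ) :
    1 - ∑ j ∈ Finset.range (m + 1), poissonPmf x j
      = ∫ t in (0 : ℝ)..x, t ^ m / (m.factorial : ℝ) * Real.exp (-t) := by
  induction m with
  | zero =>
    simp [poissonPmf]
  | succ m ih =>
    have h : ∫ t in (0 : ℝ)..x, (t ^ m / (m.factorial : ℝ) * Real.exp (-t)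
          - t ^ (m + 1) / ((m + 1).factorial : ℝ) * Real.exp (-t))
        = x ^ (m + 1) / ((m + 1).factorial : ℝ) * Real.exp (-x)
          - 0 ^ (m + 1) / ((m + 1).factorial : ℝ) * Real.exp (-0) := by
      refine integral_eq_sub_of_hasDerivAt
        (f := fun t => t ^ (m + 1) / ((m + 1).factorial : ℝ) * Real.exp (-t))
        (fun t _ => ?_) (Continuous.intervalIntegrable (by fun_prop) _ _)
      have hd := (((hasDerivAt_id t).pow (m + 1)).div_const
        ((m + 1).factorial : ℝ)).mul (hasDerivAt_id t).neg.exp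
      refine hd.congr_deriv ?_
      have : (m.factorial : ℝ) ≠ 0 := by positivity
      simp [Nat.factorial_succ]
      field_simp
      ring
    rw [intervalIntegral.integral_sub (Continuous.intervalIntegrable (by fun_prop) _ _)
      (Continuous.intervalIntegrable (by fun_prop) _ _)] at h
    simp only [ne_eq, Nat.add_eq_zero_iff,
      one_ne_zero, and_false, not_false_eq_true, zero_pow, zero_div, zero_mul, sub_zero] at h
    rw [Finset.sum_range_succ, poissonPmf]
    linear_combination ih + h

lemma hasSum_poissonPmf (x : ℝ) : HasSum (poissonPmf x) 1 := by
  have h := (NormedSpace.expSeries_div_hasSum_exp x).mul_left (Real.exp (-x))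
  rw [← Real.exp_eq_exp_ℝ, ← Real.exp_add, neg_add_cancel, Real.exp_zero] at h
  exact h.congr_fun fun j => by rw [poissonPmf, mul_div_assoc]

lemma abs_genMatch_sub_poissonPmf {x : ℝ} (hx : 0 ≤ x) {n j : ℕ} (hj : j ≤ n) :
    |genMatch n x j - poissonPmf x j|
      = ∫ t in (0 : ℝ)..x, x ^ j / (j.factorial : ℝ)
          * ((x - t) ^ (n - j) / ((n - j).factorial : ℝ)) * Real.exp (-t) := by
  have h : genMatch n x j - poissonPmf x j = x ^ j / (j.factorial : ℝ) * ((-1) ^ (n - j)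
      * ∫ t in (0 : ℝ)..x, (x - t) ^ (n - j) / ((n - j).factorial : ℝ) * Real.exp (-t)) := by
    rw [← taylor_exp_neg_sub, genMatch, if_pos hj, poissonPmf]
    ring
  have hint : 0 ≤ ∫ t in (0 : ℝ)..x, (x - t) ^ (n - j) / ((n - j).factorial : ℝ)
      * Real.exp (-t) := by
    refine intervalIntegral.integral_nonneg hx fun t ht => ?_
    have : 0 ≤ x - t := sub_nonneg.2 ht.2
    positivity
  rw [h, abs_mul, abs_mul, abs_pow, abs_neg, abs_one, one_pow, one_mul, abs_of_nonneg hint,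
    abs_of_nonneg (by positivity), ← intervalIntegral.integral_const_mul]
  simp only [mul_assoc]

/-- Binomial theorem in divided-power form. -/
lemma sum_pow_div_factorial_mul (a b : ℝ) (n : ℕ) :
    ∑ j ∈ Finset.range (n + 1),
        a ^ j / (j.factorial : ℝ) * (b ^ (n - j) / ((n - j).factorial : ℝ))
      = (a + b) ^ n / (n.factorial : ℝ) := by
  rw [add_pow, Finset.sum_div]
  refine Finset.sum_congr rfl fun j hj => ?_
  have hj : j ≤ n := Nat.lt_succ_iff.1 (Finset.mem_range.1 hj)
  rw [Nat.cast_choose ℝ hj]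
  field_simp

/-- The total variation distance as an integral against `exp (-t)`. -/
lemma dtv_genMatch_poissonPmf {x : ℝ} (hx : 0 ≤ x) (n : ℕ) :
    dtv (genMatch n x) (poissonPmf x)
      = ∫ t in (0 : ℝ)..x,
          ((2 * x - t) ^ n + t ^ n) / (2 * (n.factorial : ℝ)) * Real.exp (-t) := by
  have htail : ∀ j, |genMatch n x (j + (n + 1)) - poissonPmf x (j + (n + 1))|
      = poissonPmf x (j + (n + 1)) := fun j => by
    rw [genMatch, if_neg (by omega), zero_sub, abs_neg, abs_of_nonneg]
    rw [poissonPmf]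
    positivity
  have hsum : Summable fun j => |genMatch n x j - poissonPmf x j| := by
    rw [← summable_nat_add_iff (n + 1)]
    simp only [htail]
    exact (summable_nat_add_iff (n + 1)).2 (hasSum_poissonPmf x).summable
  have hpois := (hasSum_poissonPmf x).summable.sum_add_tsum_nat_add (n + 1)
  rw [(hasSum_poissonPmf x).tsum_eq] at hpois
  have hhead : ∑ j ∈ Finset.range (n + 1), |genMatch n x j - poissonPmf x j|
      = ∫ t in (0 : ℝ)..x, (2 * x - t) ^ n / (n.factorial : ℝ) * Real.exp (-t) := by
    rw [Finset.sum_congr rfl fun j hj => abs_genMatch_sub_poissonPmf hx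
      (Nat.lt_succ_iff.1 (Finset.mem_range.1 hj)), ← intervalIntegral.integral_finsetSum
      fun j _ => Continuous.intervalIntegrable (by fun_prop) _ _]
    refine intervalIntegral.integral_congr fun t _ => ?_
    rw [← Finset.sum_mul, sum_pow_div_factorial_mul]
    ring_nf
  rw [dtv, ← hsum.sum_add_tsum_nat_add (n + 1), hhead]
  simp only [htail]
  rw [eq_sub_of_add_eq' hpois, one_sub_sum_poissonPmf, ← intervalIntegral.integral_add
    (Continuous.intervalIntegrable (by fun_prop) _ _)
    (Continuous.intervalIntegrable (by fun_prop) _ _), ← intervalIntegral.integral_const_mul]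
  refine intervalIntegral.integral_congr fun t _ => ?_
  field_simp

lemma integral_weight_mul_quadratic (x c : ℝ) (n : ℕ) :
    ∫ t in (0 : ℝ)..x,
        ((2 * x - t) ^ n + t ^ n) / (2 * (n.factorial : ℝ)) * (1 - t + c * t ^ 2)
      = 2 ^ n * x ^ (n + 1) / ((n + 1).factorial : ℝ)
          * (1 - 2 * x / ((n : ℝ) + 2) * (1 - 1 / 2 ^ (n + 1))
            + 2 * c * (4 * x ^ 2 / (((n : ℝ) + 2) * ((n : ℝ) + 3))
                * (1 - ((n : ℝ) + 3) / 2 ^ (n + 2)))) := by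
  let F : ℝ → ℝ := fun t =>
    (-((1 - 2 * x + 4 * c * x ^ 2) * ((2 * x - t) ^ (n + 1) / ((n : ℝ) + 1))
        + (1 - 4 * c * x) * ((2 * x - t) ^ (n + 2) / ((n : ℝ) + 2))
        + c * ((2 * x - t) ^ (n + 3) / ((n : ℝ) + 3)))
      + (t ^ (n + 1) / ((n : ℝ) + 1) - t ^ (n + 2) / ((n : ℝ) + 2)
        + c * (t ^ (n + 3) / ((n : ℝ) + 3)))) / (2 * (n.factorial : ℝ))
  have hpow : ∀ (k : ℕ) (t : ℝ),
      HasDerivAt (fun t : ℝ => t ^ (n + k + 1) / ((n : ℝ) + (k + 1 : ℕ))) (t ^ (n + k)) t := by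
    intro k t
    refine ((hasDerivAt_pow (n + k + 1) t).div_const _).congr_deriv ?_
    have : (n : ℝ) + (k + 1 : ℕ) ≠ 0 := by positivity
    rw [div_eq_iff this]
    push_cast
    ring
  have hF : ∀ t, HasDerivAt F
      (((2 * x - t) ^ n + t ^ n) / (2 * (n.factorial : ℝ)) * (1 - t + c * t ^ 2)) t := by
    intro t
    have hu : HasDerivAt (fun t : ℝ => 2 * x - t) (-1) t := (hasDerivAt_id t).const_sub _
    have h0 := hpow 0
    have h1 := hpow 1
    have h2 := hpow 2
    norm_num at h0 h1 h2
    have hc := fun (k : ℕ) => (hpow k (2 * x - t)).comp t hu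
    have hc0 := hc 0
    have hc1 := hc 1
    have hc2 := hc 2
    norm_num [Function.comp_def] at hc0 hc1 hc2
    refine (((((hc0.const_mul (1 - 2 * x + 4 * c * x ^ 2)).add
      (hc1.const_mul (1 - 4 * c * x))).add (hc2.const_mul c)).neg.add
      (((h0 t).sub (h1 t)).add ((h2 t).const_mul c))).div_const _).congr_deriv ?_
    ring
  rw [integral_eq_sub_of_hasDerivAt (fun t _ => hF t)
    (Continuous.intervalIntegrable (by fun_prop) _ _)]
  have hf : (n.factorial : ℝ) ≠ 0 := by positivity
  simp only [F, Nat.factorial_succ]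
  push_cast
  rw [show 2 * x - x = x by ring, sub_zero]
  simp only [ne_eq, Nat.add_eq_zero_iff, one_ne_zero, and_false, not_false_eq_true, zero_pow,
    OfNat.ofNat_ne_zero, zero_div, mul_pow]
  field_simp
  ring

lemma exp_neg_lt_quadratic {t : ℝ} (ht : 0 < t) : Real.exp (-t) < 1 - t + t ^ 2 / 2 := by
  have h := Real.quadratic_le_exp_of_nonneg ht.le
  have hpos : 0 < 1 - t + t ^ 2 / 2 := by nlinarith [sq_nonneg (t - 1)]
  rw [Real.exp_neg, inv_lt_iff_one_lt_mul₀ (Real.exp_pos t)]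
  calc 1 < (1 - t + t ^ 2 / 2) * (1 + t + t ^ 2 / 2) := by
        have : 0 < t ^ 4 := by positivity
        linarith
    _ ≤ (1 - t + t ^ 2 / 2) * Real.exp t := by gcongr

/-- Strict monotonicity in `f` of the integral of `f` against the weight of
`dtv_genMatch_poissonPmf`. -/
lemma integral_weight_mul_lt {x : ℝ} (hx : 0 < x) (n : ℕ) {f g : ℝ → ℝ} (hf : Continuous f)
    (hg : Continuous g) (hfg : ∀ t, 0 < t → f t < g t) :
    ∫ t in (0 : ℝ)..x, ((2 * x - t) ^ n + t ^ n) / (2 * (n.factorial : ℝ)) * f t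
      < ∫ t in (0 : ℝ)..x, ((2 * x - t) ^ n + t ^ n) / (2 * (n.factorial : ℝ)) * g t := by
  have hlt : ∀ t ∈ Set.Ioc 0 x, ((2 * x - t) ^ n + t ^ n) / (2 * (n.factorial : ℝ)) * f t
      < ((2 * x - t) ^ n + t ^ n) / (2 * (n.factorial : ℝ)) * g t := fun t ht => by
    have h0 : 0 < t := ht.1
    have h1 : 0 < 2 * x - t := by linarith [ht.2]
    exact mul_lt_mul_of_pos_left (hfg t h0) (by positivity)
  exact integral_lt_integral_of_continuousOn_of_le_of_exists_lt hx
    (Continuous.continuousOn (by fun_prop)) (Continuous.continuousOn (by fun_prop))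
    (fun t ht => (hlt t ht).le) ⟨x, ⟨hx.le, le_rfl⟩, hlt x ⟨hx, le_rfl⟩⟩


theorem stmt18 (lam : ℝ) (hlam : 0 < lam ∧ lam ≤ 1) (n : ℕ) :
    dtv (genMatch n lam) (poissonPmf lam)
        > 2 ^ n * lam ^ (n + 1) / (Nat.factorial (n + 1) : ℝ)
            * (1 - 2 * lam / ((n : ℝ) + 2) * (1 - 1 / 2 ^ (n + 1))) ∧
    dtv (genMatch n lam) (poissonPmf lam)
        < 2 ^ n * lam ^ (n + 1) / (Nat.factorial (n + 1) : ℝ)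
            * (1 - 2 * lam / ((n : ℝ) + 2) * (1 - 1 / 2 ^ (n + 1))
                + 4 * lam ^ 2 / (((n : ℝ) + 2) * ((n : ℝ) + 3))
                    * (1 - ((n : ℝ) + 3) / 2 ^ (n + 2))) := by
  have hx := hlam.1
  have hint := dtv_genMatch_poissonPmf hx.le n
  have hlow := integral_weight_mul_lt hx n (f := fun t => 1 - t + 0 * t ^ 2)
    (g := fun t => Real.exp (-t)) (by fun_prop) (by fun_prop)
    (fun t ht => by linarith [Real.add_one_lt_exp (neg_ne_zero.2 ht.ne')])
  have hupp := integral_weight_mul_lt hx n (f := fun t => Real.exp (-t))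
    (g := fun t => 1 - t + 1 / 2 * t ^ 2) (by fun_prop) (by fun_prop)
    (fun t ht => by linarith [exp_neg_lt_quadratic ht])
  rw [integral_weight_mul_quadratic, ← hint] at hlow hupp
  norm_num only [mul_zero, zero_mul, add_zero, one_mul, mul_one_div_cancel] at hlow hupp ⊢
  exact ⟨hlow, hupp⟩
end
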